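/- arXiv:math/0508409 — 3 statements merged into one kernel-verified Lean document; each statement's English description precedes it below -/
import Mathlib

section
/- Let p ≥ 5 be a prime and m ≥ 2 an integer with p ∤ m. Then (−1)^{((p−1)/2)·⌊m/2⌋} (m/p) (2/p)^{m−1} q^{2m Σ_{k=1}^{⌊m/2⌋} C(⌊kp/m⌋+1, 2)} ∏_{k=1}^{⌊m/2⌋} [p−1 choose ⌊kp/m⌋]_{q^{2m}} ≡ 1 + m[p]_q·EQ*_p(m,q) + (2⌊m/2⌋+1)[p]_{q^m}·Q_p(2,q^m) − m[p]_q·Q_p(2,q) + m(|R_p(m)| + 2 Σ_{j=1}^{(p−1)/2} ⌊jm/p⌋)(1−q^p) (mod [p]_q^2), where C(a,2) = a(a−1)/2 is the ordinary binomial coefficient. -/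
open Polynomial Finset

/-- The indeterminate `q` as an element of the rational function field `ℚ(q)`. -/
noncomputable def q : RatFunc ℚ := algebraMap (Polynomial ℚ) (RatFunc ℚ) Polynomial.X

/-- The `q`-integer `[n]_a = 1 + a + ⋯ + a^(n-1)` with base `a ∈ ℚ(q)`. -/
noncomputable def qn (a : RatFunc ℚ) (n : ℕ) : RatFunc ℚ := ∑ i ∈ Finset.range n, a ^ i

/-- The `q`-Pochhammer symbol `(x; a)_n = ∏_{i=0}^{n-1} (1 - x a^i)`. -/
noncomputable def qpoch (x a : RatFunc ℚ) (n : ℕ) : RatFunc ℚ :=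
  ∏ i ∈ Finset.range n, (1 - x * a ^ i)

/-- The Gaussian binomial coefficient `[n choose k]_a = (a;a)_n / ((a;a)_k (a;a)_{n-k})`. -/
noncomputable def qbinom (a : RatFunc ℚ) (n k : ℕ) : RatFunc ℚ :=
  qpoch a a n / (qpoch a a k * qpoch a a (n - k))

/-- The polynomial `q`-integer `[n]_a = 1 + a + ⋯ + a^(n-1)` with base `a ∈ ℚ[q]`. -/
noncomputable def pqn (a : Polynomial ℚ) (n : ℕ) : Polynomial ℚ := ∑ i ∈ Finset.range n, a ^ i

/-- `A ≡ B (mod g)`: the rational function `(A - B)/g`, written in lowest terms,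
has denominator coprime to `g`. -/
def qCong (g : Polynomial ℚ) (A B : RatFunc ℚ) : Prop :=
  IsCoprime (((A - B) / algebraMap (Polynomial ℚ) (RatFunc ℚ) g).denom) g

/-- The `q`-Fermat quotient `Q_p(m, a) = ((a^m; a^m)_{p-1} / (a; a)_{p-1} - 1) / [p]_a`. -/
noncomputable def QF (p m : ℕ) (a : RatFunc ℚ) : RatFunc ℚ :=
  (qpoch (a ^ m) (a ^ m) (p - 1) / qpoch a a (p - 1) - 1) / qn a p

/-- `⟨x⟩_p`: the least non-negative residue of the integer `x` modulo `p`. -/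
def res (p : ℕ) (x : ℤ) : ℕ := (x % (p : ℤ)).toNat

/-- `R_p(m) = {j : 1 ≤ j < p/2, ⟨jm⟩_p > p/2}` (for odd `p`, `1 ≤ j < p/2` means
`1 ≤ j ≤ (p-1)/2`, and `⟨jm⟩_p > p/2` means `2⟨jm⟩_p > p`). -/
def Rset (p : ℕ) (m : ℤ) : Finset ℕ :=
  (Finset.Icc 1 ((p - 1) / 2)).filter fun j => p < 2 * res p ((j : ℤ) * m)

/-- `EQ*_p(m,q) = ((m/p) q^(2Σ_{j∈R_p(m)}(p-⟨jm⟩_p)) (q^(2m);q^(2m))_{(p-1)/2} /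
(q^2;q^2)_{(p-1)/2} - 1) / [p]_q`. -/
noncomputable def EQstar (p : ℕ) [Fact p.Prime] (m : ℕ) : RatFunc ℚ :=
  ((legendreSym p m : RatFunc ℚ) *
      q ^ (2 * ∑ j ∈ Rset p (m : ℤ), (p - res p ((j : ℤ) * m))) *
      (qpoch (q ^ (2 * m)) (q ^ (2 * m)) ((p - 1) / 2) /
        qpoch (q ^ 2) (q ^ 2) ((p - 1) / 2)) - 1) / qn q p

/-! ### Residues of multiples and parity -/

theorem res_natCast_mul (p j m : ℕ) : res p ((j : ℤ) * (m : ℤ)) = j * m % p := by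
  unfold res
  exact_mod_cast Int.toNat_natCast (j * m % p)

/-- The absolute value of the absolutely least residue of `j * m` modulo `p`. -/
def absRes (p m j : ℕ) : ℕ := if p < 2 * (j * m % p) then p - j * m % p else j * m % p

theorem absRes_eq_natAbs_valMinAbs (p m j : ℕ) [Fact p.Prime] :
    absRes p m j = ((m : ZMod p) * (j : ZMod p)).valMinAbs.natAbs := by
  rw [ZMod.valMinAbs_natAbs_eq_min, ← Nat.cast_mul, ZMod.val_natCast, mul_comm m j, absRes]
  have := Nat.mod_lt (j * m) (Fact.out : p.Prime).pos
  split_ifs <;> omega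

theorem Icc_one_half_eq {p : ℕ} (hodd : Odd p) :
    Icc 1 ((p - 1) / 2) = Ico 1 (p / 2).succ := by
  obtain ⟨t, rfl⟩ := hodd
  ext x
  simp only [mem_Icc, mem_Ico]
  omega

theorem natCast_ne_zero_of_not_dvd {p m : ℕ} (hpm : ¬ p ∣ m) : (m : ZMod p) ≠ 0 := by
  rwa [Ne, ZMod.natCast_eq_zero_iff]

theorem prod_absRes {M : Type*} [CommMonoid M] {p m : ℕ} [Fact p.Prime] (hodd : Odd p)
    (hpm : ¬ p ∣ m) (f : ℕ → M) :
    ∏ j ∈ Icc 1 ((p - 1) / 2), f (absRes p m j) = ∏ j ∈ Icc 1 ((p - 1) / 2), f j := by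
  have h := ZMod.Ico_map_valMinAbs_natAbs_eq_Ico_map_id p (m : ZMod p)
    (natCast_ne_zero_of_not_dvd hpm)
  rw [Icc_one_half_eq hodd]
  simp only [absRes_eq_natAbs_valMinAbs]
  have h' := congrArg (fun s => (s.map f).prod) h
  simp only [Multiset.map_map] at h'
  exact h'

theorem sum_absRes {M : Type*} [AddCommMonoid M] {p m : ℕ} [Fact p.Prime] (hodd : Odd p)
    (hpm : ¬ p ∣ m) (f : ℕ → M) :
    ∑ j ∈ Icc 1 ((p - 1) / 2), f (absRes p m j) = ∑ j ∈ Icc 1 ((p - 1) / 2), f j :=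
  prod_absRes (M := Multiplicative M) hodd hpm f

theorem mem_Rset_iff {p m j : ℕ} :
    j ∈ Rset p (m : ℤ) ↔ j ∈ Icc 1 ((p - 1) / 2) ∧ p < 2 * (j * m % p) := by
  rw [Rset, mem_filter, res_natCast_mul]

theorem legendreSym_eq_neg_one_pow_card_Rset {p m : ℕ} [Fact p.Prime] (hodd : Odd p)
    (hpm : ¬ p ∣ m) : legendreSym p m = (-1) ^ (Rset p (m : ℤ)).card := by
  rw [ZMod.gauss_lemma (by rintro rfl; exact absurd hodd (by decide))
    (by exact_mod_cast natCast_ne_zero_of_not_dvd hpm), Rset, Icc_one_half_eq hodd]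
  congr 2
  ext x
  have : (((m : ℤ) : ZMod p) * (x : ZMod p)).val = x * m % p := by
    rw [Int.cast_natCast, ← Nat.cast_mul, ZMod.val_natCast, mul_comm]
  obtain ⟨t, ht⟩ := hodd
  rw [mem_filter, mem_filter, this, res_natCast_mul]
  refine and_congr_right fun _ => ?_
  omega

theorem not_dvd_mul_of_mem_Icc {p m j : ℕ} [Fact p.Prime] (hpm : ¬ p ∣ m)
    (hj : j ∈ Icc 1 ((p - 1) / 2)) : ¬ p ∣ j * m := by
  rw [mem_Icc] at hj
  rw [(Fact.out : p.Prime).dvd_mul, not_or]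
  exact ⟨Nat.not_dvd_of_pos_of_lt hj.1 (by omega), hpm⟩

theorem sum_mul_parity {p m : ℕ} [Fact p.Prime] (hodd : Odd p) (hpm : ¬ p ∣ m) :
    (m : ZMod 2) * ((∑ j ∈ Icc 1 ((p - 1) / 2), j : ℕ) : ZMod 2) =
      ((∑ j ∈ Icc 1 ((p - 1) / 2), j * m / p : ℕ) : ZMod 2) +
        ((∑ j ∈ Icc 1 ((p - 1) / 2), j : ℕ) : ZMod 2) +
        ((Rset p (m : ℤ)).card : ZMod 2) := by
  have hp1 : (p : ZMod 2) = 1 := ZMod.natCast_eq_one_iff_odd.2 hodd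
  have hR : (Rset p (m : ℤ)).card =
      ∑ j ∈ Icc 1 ((p - 1) / 2), if p < 2 * (j * m % p) then 1 else 0 := by
    rw [← card_filter]
    congr 1
  rw [← sum_absRes hodd hpm (fun j => j), hR, sum_absRes hodd hpm (fun j => j)]
  conv_rhs => rw [← sum_absRes hodd hpm (fun j => j)]
  simp only [Nat.cast_sum, mul_sum, ← sum_add_distrib]
  refine sum_congr rfl fun j _ => ?_
  have hlt := Nat.mod_lt (j * m) (Fact.out : p.Prime).pos
  have hd := congrArg (Nat.cast : ℕ → ZMod 2) (Nat.div_add_mod (j * m) p)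
  push_cast [hp1] at hd
  have h2 : (2 : ZMod 2) = 0 := rfl
  unfold absRes
  split_ifs with h
  · rw [Nat.cast_sub hlt.le, hp1]
    push_cast
    linear_combination -hd + ((j * m % p : ℕ) - 1 : ZMod 2) * h2
  · linear_combination -hd

theorem neg_one_pow_eq_of_natCast_eq {R : Type*} [Ring R] {a b : ℕ} (h : (a : ZMod 2) = b) :
    (-1 : R) ^ a = (-1) ^ b := by
  rw [neg_one_pow_eq_pow_mod_two, neg_one_pow_eq_pow_mod_two (n := b),
    (ZMod.natCast_eq_natCast_iff' a b 2).1 h]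

/-- Summing over the lattice points strictly below a diagonal, by columns or by rows. -/
theorem sum_sum_Icc_mul_div {M : Type*} [AddCommGroup M] {p m : ℕ} [Fact p.Prime]
    (hodd : Odd p) (hm : 0 < m) (hpm : ¬ p ∣ m) (f : ℕ → M) :
    ∑ k ∈ Icc 1 (m / 2), ∑ i ∈ Icc 1 (k * p / m), f i =
      ∑ i ∈ Icc 1 ((p - 1) / 2), (m / 2 - i * m / p) • f i := by
  have hp := (Fact.out : p.Prime).pos
  obtain ⟨t, ht⟩ := hodd
  have hmem : ∀ k i : ℕ, (k ∈ Icc 1 (m / 2) ∧ i ∈ Icc 1 (k * p / m)) ↔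
      (k ∈ Icc (i * m / p + 1) (m / 2) ∧ i ∈ Icc 1 ((p - 1) / 2)) := by
    intro k i
    simp only [mem_Icc, Nat.le_div_iff_mul_le hm, Nat.add_one_le_iff, Nat.div_lt_iff_lt_mul hp]
    constructor
    · rintro ⟨⟨hk1, hk2⟩, hi1, hi2⟩
      have hk : k * 2 ≤ m := by omega
      have hi : i ≤ (p - 1) / 2 := by
        have : 2 * i * m ≤ p * m := by nlinarith
        have := Nat.le_of_mul_le_mul_right this hm
        omega
      refine ⟨⟨lt_of_le_of_ne hi2 fun h => ?_, hk2⟩, hi1, hi⟩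
      exact not_dvd_mul_of_mem_Icc hpm (mem_Icc.2 ⟨hi1, hi⟩) ⟨k, by rw [h, mul_comm]⟩
    · rintro ⟨⟨h1, h2⟩, h3, h4⟩
      refine ⟨⟨?_, h2⟩, h3, h1.le⟩
      by_contra h0
      have : k = 0 := by omega
      simp [this] at h1
  rw [sum_comm' hmem]
  refine sum_congr rfl fun i _ => ?_
  rw [sum_const, Nat.card_Icc, Nat.add_sub_add_right]

theorem sign_eq_one {p m : ℕ} [Fact p.Prime] (hodd : Odd p) (hm : 0 < m) (hpm : ¬ p ∣ m) :
    (-1 : RatFunc ℚ) ^ (((p - 1) / 2) * (m / 2)) * (legendreSym p m : RatFunc ℚ) *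
      (legendreSym p 2 : RatFunc ℚ) ^ (m - 1) *
      (-1) ^ (∑ k ∈ Icc 1 (m / 2), k * p / m) = 1 := by
  have hp2 : ¬ p ∣ 2 := fun h => by
    rw [Nat.prime_dvd_prime_iff_eq Fact.out Nat.prime_two] at h
    subst h
    exact absurd hodd (by decide)
  have hlat := ZMod.sum_mul_div_add_sum_mul_div_eq_mul p m (natCast_ne_zero_of_not_dvd hpm)
  rw [← Icc_one_half_eq hodd] at hlat
  have hIcc : Ico 1 (m / 2).succ = Icc 1 (m / 2) := rfl
  have hhalf : p / 2 = (p - 1) / 2 := by obtain ⟨t, rfl⟩ := hodd; omega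
  rw [hIcc, hhalf] at hlat
  have h2 := legendreSym_eq_neg_one_pow_card_Rset hodd hp2
  rw [Nat.cast_ofNat] at h2
  rw [legendreSym_eq_neg_one_pow_card_Rset hodd hpm, h2]
  push_cast
  rw [← pow_mul, ← pow_add, ← pow_add, ← pow_add, ← pow_zero (-1 : RatFunc ℚ)]
  apply neg_one_pow_eq_of_natCast_eq
  have hs2 := sum_mul_parity hodd hp2
  have hz : ∑ j ∈ Icc 1 ((p - 1) / 2), j * 2 / p = 0 := by
    refine sum_eq_zero fun j hj => Nat.div_eq_of_lt ?_
    rw [mem_Icc] at hj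
    omega
  have hsm := sum_mul_parity hodd hpm
  have htwo : (2 : ZMod 2) = 0 := rfl
  rw [hz] at hs2
  rw [← hlat]
  obtain ⟨n, rfl⟩ : ∃ n, m = n + 1 := ⟨m - 1, by omega⟩
  simp only [Nat.cast_ofNat, Nat.add_sub_cancel] at hs2 ⊢
  push_cast at hs2 hsm ⊢
  generalize ((Rset p 2).card : ZMod 2) = R2 at *
  generalize ((Rset p ((n : ℤ) + 1)).card : ZMod 2) = R at *
  generalize (∑ j ∈ Icc 1 ((p - 1) / 2), ((j * (n + 1) / p : ℕ) : ZMod 2)) = F at *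
  generalize (∑ j ∈ Icc 1 ((p - 1) / 2), (j : ZMod 2)) = T at *
  generalize (∑ j ∈ Icc 1 ((n + 1) / 2), ((j * p / (n + 1) : ℕ) : ZMod 2)) = S at *
  linear_combination -(n : ZMod 2) * hs2 - hsm + (S + n * T) * htwo

/-! ### Rational functions regular modulo `[p]_q` -/

theorem algebraMap_pqn (p : ℕ) :
    algebraMap (Polynomial ℚ) (RatFunc ℚ) (pqn Polynomial.X p) = qn q p := by
  simp [pqn, qn, q]

theorem pqn_eq_cyclotomic (p : ℕ) [Fact p.Prime] :
    pqn Polynomial.X p = cyclotomic p ℚ := (cyclotomic_prime ℚ p).symm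

theorem isCoprime_one_sub_X_pow_pqn {p k : ℕ} [Fact p.Prime] (hk : ¬ p ∣ k) :
    IsCoprime (1 - Polynomial.X ^ k : Polynomial ℚ) (pqn Polynomial.X p) := by
  have hk0 : 0 < k := Nat.pos_of_ne_zero fun h => hk (h ▸ dvd_zero p)
  rw [← neg_sub, IsCoprime.neg_left_iff, ← prod_cyclotomic_eq_X_pow_sub_one hk0,
    pqn_eq_cyclotomic]
  refine IsCoprime.prod_left fun d hd => cyclotomic.isCoprime_rat fun h => hk ?_
  rw [← h]
  exact Nat.dvd_of_mem_divisors hd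

theorem one_sub_q_pow_ne_zero {k : ℕ} (hk : 0 < k) : 1 - q ^ k ≠ 0 := by
  have h : (1 - q ^ k : RatFunc ℚ) =
      algebraMap (Polynomial ℚ) (RatFunc ℚ) (1 - Polynomial.X ^ k) := by simp [q]
  rw [h]
  refine RatFunc.algebraMap_ne_zero fun h0 => ?_
  have := congrArg (Polynomial.eval 0) h0
  simp [hk.ne'] at this

theorem one_sub_q_pow_ne_zero_of_not_dvd {p k : ℕ} (hk : ¬ p ∣ k) : 1 - q ^ k ≠ 0 :=
  one_sub_q_pow_ne_zero (Nat.pos_of_ne_zero fun h => hk (h.symm ▸ dvd_zero p))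

/-- The local ring of rational functions whose denominator is coprime to `[p]_q`. -/
noncomputable def regRing (p : ℕ) : Subring (RatFunc ℚ) where
  carrier := {f | IsCoprime f.denom (pqn Polynomial.X p)}
  mul_mem' ha hb := (IsCoprime.mul_left ha hb).of_isCoprime_of_dvd_left (RatFunc.denom_mul_dvd _ _)
  one_mem' := by simp [isCoprime_one_left]
  add_mem' ha hb := (IsCoprime.mul_left ha hb).of_isCoprime_of_dvd_left (RatFunc.denom_add_dvd _ _)
  zero_mem' := by simp [isCoprime_one_left]
  neg_mem' {x} hx := by
    have h := (IsCoprime.mul_left (isCoprime_one_left (x := pqn Polynomial.X p)) hx)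
    have h1 : (-1 : RatFunc ℚ).denom = 1 := by
      simpa using RatFunc.denom_algebraMap (-1 : Polynomial ℚ)
    refine h.of_isCoprime_of_dvd_left ?_
    simpa [h1] using RatFunc.denom_mul_dvd (-1) x

theorem mem_regRing {p : ℕ} {f : RatFunc ℚ} :
    f ∈ regRing p ↔ IsCoprime f.denom (pqn Polynomial.X p) := Iff.rfl

theorem algebraMap_mem_regRing (p : ℕ) (f : Polynomial ℚ) :
    algebraMap (Polynomial ℚ) (RatFunc ℚ) f ∈ regRing p := by
  rw [mem_regRing, RatFunc.denom_algebraMap]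
  exact isCoprime_one_left

theorem q_mem_regRing (p : ℕ) : q ∈ regRing p := algebraMap_mem_regRing p _

theorem half_mem_regRing (p : ℕ) : (1 / 2 : RatFunc ℚ) ∈ regRing p := by
  have h := algebraMap_mem_regRing p (Polynomial.C (1 / 2))
  rwa [RatFunc.algebraMap_C, map_div₀, map_one, map_ofNat] at h

theorem inv_one_sub_q_pow_mem_regRing {p k : ℕ} [Fact p.Prime] (hk : ¬ p ∣ k) :
    (1 - q ^ k)⁻¹ ∈ regRing p := by
  have h : ((1 - q ^ k)⁻¹ : RatFunc ℚ) = algebraMap (Polynomial ℚ) (RatFunc ℚ) 1 /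
      algebraMap (Polynomial ℚ) (RatFunc ℚ) (1 - Polynomial.X ^ k) := by simp [q]
  rw [mem_regRing, h]
  exact (isCoprime_one_sub_X_pow_pqn hk).of_isCoprime_of_dvd_left (RatFunc.denom_div_dvd _ _)

theorem qCong_of_sub_eq {p : ℕ} {A B c : RatFunc ℚ} (hp : 0 < p) (hc : c ∈ regRing p)
    (h : A - B = (q ^ p - 1) ^ 2 * c) : qCong (pqn Polynomial.X p ^ 2) A B := by
  have hq : q ^ p - 1 = (q - 1) * qn q p := by rw [mul_comm, qn, geom_sum_mul]
  have hne : qn q p ≠ 0 := fun h0 => one_sub_q_pow_ne_zero hp (by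
    rw [← neg_sub, hq, h0, mul_zero, neg_zero])
  have hmem : (A - B) / algebraMap (Polynomial ℚ) (RatFunc ℚ) (pqn Polynomial.X p ^ 2) ∈
      regRing p := by
    rw [map_pow, algebraMap_pqn, h, hq]
    have : ((q - 1) * qn q p) ^ 2 * c / qn q p ^ 2 = (q - 1) ^ 2 * c := by field_simp
    rw [this]
    exact mul_mem (pow_mem (sub_mem (q_mem_regRing p) (one_mem _)) 2) hc
  exact IsCoprime.pow_right hmem

/-! ### First order expansions in `q ^ p - 1` -/

/-- Congruence modulo the ideal generated by `q ^ p - 1` in `regRing p`. -/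
def CongFirst (p : ℕ) (x y : RatFunc ℚ) : Prop := ∃ c ∈ regRing p, x - y = (q ^ p - 1) * c

/-- `A` agrees with `1 + (q ^ p - 1) * s` modulo `(q ^ p - 1) ^ 2`. -/
def HasExpansion (p : ℕ) (A s : RatFunc ℚ) : Prop :=
  s ∈ regRing p ∧ ∃ c ∈ regRing p, A = 1 + (q ^ p - 1) * s + (q ^ p - 1) ^ 2 * c

theorem q_pow_sub_one_mem_regRing (p k : ℕ) : q ^ k - 1 ∈ regRing p :=
  sub_mem (pow_mem (q_mem_regRing p) k) (one_mem _)

theorem CongFirst.symm {p : ℕ} {x y : RatFunc ℚ} (h : CongFirst p x y) : CongFirst p y x := by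
  obtain ⟨c, hc, h⟩ := h
  exact ⟨-c, neg_mem hc, by linear_combination -h⟩

theorem CongFirst.one_sub {p : ℕ} {x y : RatFunc ℚ} (h : CongFirst p x y) :
    CongFirst p (1 - x) (1 - y) := by
  obtain ⟨c, hc, h⟩ := h
  exact ⟨-c, neg_mem hc, by linear_combination -h⟩

theorem CongFirst.mem_left {p : ℕ} {x y : RatFunc ℚ} (h : CongFirst p x y)
    (hy : y ∈ regRing p) : x ∈ regRing p := by
  obtain ⟨c, hc, h⟩ := h
  rw [sub_eq_iff_eq_add] at h
  exact h ▸ add_mem (mul_mem (q_pow_sub_one_mem_regRing p p) hc) hy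

theorem HasExpansion.one (p : ℕ) : HasExpansion p 1 0 :=
  ⟨zero_mem _, 0, zero_mem _, by ring⟩

theorem HasExpansion.mul {p : ℕ} {A B s t : RatFunc ℚ} (hA : HasExpansion p A s)
    (hB : HasExpansion p B t) : HasExpansion p (A * B) (s + t) := by
  obtain ⟨hs, c, hc, rfl⟩ := hA
  obtain ⟨ht, d, hd, rfl⟩ := hB
  have he := q_pow_sub_one_mem_regRing p p
  refine ⟨add_mem hs ht, c + d + s * t + (q ^ p - 1) * (s * d + c * t) +
    (q ^ p - 1) ^ 2 * (c * d), ?_, by ring⟩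
  exact add_mem (add_mem (add_mem (add_mem hc hd) (mul_mem hs ht))
    (mul_mem he (add_mem (mul_mem hs hd) (mul_mem hc ht)))) (mul_mem (pow_mem he 2) (mul_mem hc hd))

theorem HasExpansion.prod {ι : Type*} {p : ℕ} {S : Finset ι} {A s : ι → RatFunc ℚ}
    (h : ∀ i ∈ S, HasExpansion p (A i) (s i)) :
    HasExpansion p (∏ i ∈ S, A i) (∑ i ∈ S, s i) := by
  classical
  induction S using Finset.induction_on with
  | empty => simpa using HasExpansion.one p
  | insert a S ha ih =>
    rw [prod_insert ha, sum_insert ha]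
    exact (h a (mem_insert_self a S)).mul (ih fun i hi => h i (mem_insert_of_mem hi))

theorem HasExpansion.q_pow_mul (p f : ℕ) : HasExpansion p (q ^ (p * f)) f := by
  have h : HasExpansion p (q ^ p) 1 := ⟨one_mem _, 0, zero_mem _, by ring⟩
  simpa [pow_mul] using HasExpansion.prod (S := Finset.range f) fun _ _ => h

theorem HasExpansion.of_congFirst {p f : ℕ} {x t : RatFunc ℚ} (h : CongFirst p x t)
    (ht : t ∈ regRing p) : HasExpansion p (1 + (q ^ (p * f) - 1) * x) (f * t) := by
  have hx := h.mem_left ht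
  obtain ⟨c, hc, h⟩ := h
  obtain ⟨-, d, hd, hf⟩ := HasExpansion.q_pow_mul p f
  have hfm : (f : RatFunc ℚ) ∈ regRing p := natCast_mem _ f
  refine ⟨mul_mem hfm ht, f * c + d * x, add_mem (mul_mem hfm hc) (mul_mem hd hx), ?_⟩
  rw [hf]
  linear_combination (q ^ p - 1) * f * h

theorem congFirst_inv_one_sub_of_dvd_sub {p k l f : ℕ} [Fact p.Prime] (hl : ¬ p ∣ l)
    (hkl : k = l + p * f) : CongFirst p (1 - q ^ k)⁻¹ (1 - q ^ l)⁻¹ := by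
  have hk : ¬ p ∣ k := by rwa [hkl, Nat.dvd_add_left (Dvd.intro f rfl)]
  have hk0 := one_sub_q_pow_ne_zero_of_not_dvd hk
  have hl0 := one_sub_q_pow_ne_zero_of_not_dvd hl
  obtain ⟨-, d, hd, hf⟩ := HasExpansion.q_pow_mul p f
  refine ⟨q ^ l * (1 - q ^ k)⁻¹ * (1 - q ^ l)⁻¹ * (f + (q ^ p - 1) * d), ?_, ?_⟩
  · exact mul_mem (mul_mem (mul_mem (pow_mem (q_mem_regRing p) l)
      (inv_one_sub_q_pow_mem_regRing hk)) (inv_one_sub_q_pow_mem_regRing hl))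
      (add_mem (natCast_mem _ f) (mul_mem (q_pow_sub_one_mem_regRing p p) hd))
  · have hk' : q ^ k = q ^ l * q ^ (p * f) := by rw [hkl, pow_add]
    field_simp
    rw [hk', hf]
    ring

theorem congFirst_inv_one_sub_of_dvd_add {p k l f : ℕ} [Fact p.Prime] (hl : ¬ p ∣ l)
    (hkl : k + l = p * f) : CongFirst p (1 - q ^ k)⁻¹ (1 - (1 - q ^ l)⁻¹) := by
  have hk : ¬ p ∣ k := fun h => hl ((Nat.dvd_add_right h).1 (hkl ▸ Dvd.intro f rfl))
  have hk0 := one_sub_q_pow_ne_zero_of_not_dvd hk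
  have hl0 := one_sub_q_pow_ne_zero_of_not_dvd hl
  obtain ⟨-, d, hd, hf⟩ := HasExpansion.q_pow_mul p f
  refine ⟨-((1 - q ^ k)⁻¹ * (1 - q ^ l)⁻¹ * (f + (q ^ p - 1) * d)), ?_, ?_⟩
  · exact neg_mem (mul_mem (mul_mem
      (inv_one_sub_q_pow_mem_regRing hk) (inv_one_sub_q_pow_mem_regRing hl))
      (add_mem (natCast_mem _ f) (mul_mem (q_pow_sub_one_mem_regRing p p) hd)))
  · have hk' : q ^ k * q ^ l = 1 + (q ^ p - 1) * f + (q ^ p - 1) ^ 2 * d := by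
      rw [← pow_add, hkl, hf]
    field_simp
    linear_combination -hk'

/-- A representative of `1 / (1 - q ^ a)` modulo `[p]_q`, for `a` a residue modulo `p`,
chosen to satisfy `invRep (-a) = 1 - invRep a` exactly. -/
noncomputable def invRep {p : ℕ} (a : ZMod p) : RatFunc ℚ :=
  1 / 2 * (1 + (1 - q ^ a.val)⁻¹ - (1 - q ^ (-a).val)⁻¹)

theorem invRep_neg {p : ℕ} (a : ZMod p) : invRep (-a) = 1 - invRep a := by
  unfold invRep
  rw [neg_neg]
  ring

theorem congFirst_invRep {p k : ℕ} [Fact p.Prime] (hk : ¬ p ∣ k) :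
    CongFirst p (1 - q ^ k)⁻¹ (invRep (k : ZMod p)) := by
  have hp := (Fact.out : p.Prime).pos
  have hv : (k : ZMod p).val = k % p := ZMod.val_natCast p k
  have hv' : (-(k : ZMod p)).val = p - k % p := by
    have : NeZero (k : ZMod p) := ⟨natCast_ne_zero_of_not_dvd hk⟩
    rw [ZMod.val_neg_of_ne_zero, hv]
  have hr : ¬ p ∣ k % p := by rwa [Nat.dvd_mod_iff dvd_rfl]
  have hlt := Nat.mod_lt k hp
  have hr' : ¬ p ∣ p - k % p := by
    intro h
    exact hr ((Nat.dvd_sub_iff_right hlt.le dvd_rfl).1 h)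
  obtain ⟨c, hc, h⟩ := congFirst_inv_one_sub_of_dvd_sub (f := k / p) hr
    (Nat.mod_add_div k p).symm
  obtain ⟨d, hd, h'⟩ := congFirst_inv_one_sub_of_dvd_add (k := k) (f := k / p + 1) hr' (by
    have := Nat.mod_add_div k p
    rw [mul_add]
    omega)
  refine ⟨1 / 2 * (c + d), mul_mem (half_mem_regRing p) (add_mem hc hd), ?_⟩
  rw [invRep, hv, hv']
  linear_combination (1 / 2 : RatFunc ℚ) * (h + h')

theorem invRep_mem_regRing {p k : ℕ} [Fact p.Prime] (hk : ¬ p ∣ k) :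
    invRep (k : ZMod p) ∈ regRing p :=
  (congFirst_invRep hk).symm.mem_left (inv_one_sub_q_pow_mem_regRing hk)

/-! ### Product formulas -/

theorem prod_Icc_one_eq_prod_range {M : Type*} [CommMonoid M] (f : ℕ → M) (n : ℕ) :
    ∏ i ∈ Icc 1 n, f i = ∏ i ∈ range n, f (i + 1) := by
  induction n with
  | zero => simp
  | succ n ih => rw [prod_Icc_succ_top (Nat.le_add_left 1 n), ih, prod_range_succ]

theorem qpoch_self (a : RatFunc ℚ) (n : ℕ) : qpoch a a n = ∏ i ∈ Icc 1 n, (1 - a ^ i) := by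
  rw [prod_Icc_one_eq_prod_range, qpoch]
  exact prod_congr rfl fun i _ => by rw [pow_succ']

theorem qpoch_self_ne_zero {a : RatFunc ℚ} (ha : ∀ i, 0 < i → 1 - a ^ i ≠ 0) (n : ℕ) :
    qpoch a a n ≠ 0 := by
  rw [qpoch_self, prod_ne_zero_iff]
  exact fun i hi => ha i (mem_Icc.1 hi).1

theorem qpoch_self_succ (a : RatFunc ℚ) (n : ℕ) :
    qpoch a a (n + 1) = qpoch a a n * (1 - a ^ (n + 1)) := by
  rw [qpoch, prod_range_succ, pow_succ', qpoch]

theorem qbinom_pred_eq_prod {a : RatFunc ℚ} (ha : ∀ i, 0 < i → 1 - a ^ i ≠ 0) {p n : ℕ}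
    (hn : n < p) :
    qbinom a (p - 1) n * a ^ (n + 1).choose 2 * (-1) ^ n =
      ∏ i ∈ Icc 1 n, (1 + (a ^ p - 1) * (1 - a ^ i)⁻¹) := by
  induction n with
  | zero => simp [qbinom, qpoch_self_ne_zero ha, show qpoch a a 0 = 1 from prod_range_zero _]
  | succ n ih =>
    rw [prod_Icc_succ_top (Nat.le_add_left 1 n), ← ih (by omega)]
    obtain ⟨r, rfl⟩ : ∃ r, p = n + 1 + (r + 1) := ⟨p - (n + 2), by omega⟩
    have h1 : n + 1 + (r + 1) - 1 - n = r + 1 := by omega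
    have h2 : n + 1 + (r + 1) - 1 - (n + 1) = r := by omega
    have hch : (n + 1 + 1).choose 2 = n + 1 + (n + 1).choose 2 := by
      rw [Nat.choose_succ_succ' (n + 1) 1, Nat.choose_one_right]
    rw [qbinom, qbinom, h1, h2, qpoch_self_succ a r, qpoch_self_succ a n, hch]
    have := qpoch_self_ne_zero ha n
    have := qpoch_self_ne_zero ha r
    have := ha (n + 1) n.succ_pos
    have := ha (r + 1) r.succ_pos
    field_simp
    ring

theorem prod_range_two_mul_even_odd {M : Type*} [CommMonoid M] (f : ℕ → M) (h : ℕ) :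
    ∏ i ∈ range (2 * h), f (i + 1) =
      (∏ i ∈ range h, f (2 * (i + 1))) * ∏ i ∈ range h, f (2 * h + 1 - 2 * (i + 1)) := by
  have hr : ∏ i ∈ range h, f (2 * h + 1 - 2 * (i + 1)) = ∏ i ∈ range h, f (2 * i + 1) := by
    rw [← prod_range_reflect (fun i => f (2 * i + 1))]
    refine prod_congr rfl fun i hi => congrArg f ?_
    rw [mem_range] at hi
    omega
  rw [hr]
  clear hr
  induction h with
  | zero => simp
  | succ h ih =>
    rw [Nat.mul_succ, prod_range_succ, prod_range_succ, ih, prod_range_succ, prod_range_succ]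
    rw [show 2 * h + 1 + 1 = 2 * (h + 1) by ring]
    simp only [mul_assoc, mul_comm, mul_left_comm]

theorem prod_range_two_mul_reflect {M : Type*} [CommMonoid M] (f : ℕ → M) (h : ℕ) :
    ∏ i ∈ range (2 * h), f (i + 1) =
      (∏ i ∈ range h, f (i + 1)) * ∏ i ∈ range h, f (2 * h + 1 - (i + 1)) := by
  rw [two_mul, prod_range_add, ← prod_range_reflect (fun i => f (h + i + 1)) h]
  congr 1
  refine prod_congr rfl fun i hi => congrArg f ?_
  rw [mem_range] at hi
  omega

theorem qpoch_sq_div_qpoch_eq_prod {a : RatFunc ℚ} (ha : ∀ i, 0 < i → 1 - a ^ i ≠ 0) {p : ℕ}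
    (hodd : Odd p) :
    qpoch (a ^ 2) (a ^ 2) (p - 1) / qpoch a a (p - 1) =
      ∏ i ∈ Icc 1 ((p - 1) / 2), (1 + (a ^ p - 1) * (1 - (1 - a ^ (p - 2 * i))⁻¹)) := by
  obtain ⟨h, rfl⟩ := hodd
  rw [div_eq_iff (qpoch_self_ne_zero ha _), qpoch_self, qpoch_self]
  simp only [prod_Icc_one_eq_prod_range, Nat.add_sub_cancel, Nat.mul_div_cancel_left h two_pos]
  rw [prod_range_two_mul_reflect (fun i => 1 - (a ^ 2) ^ i),
    prod_range_two_mul_even_odd (fun i => 1 - a ^ i), mul_left_comm]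
  simp only [← pow_mul]
  congr 1
  rw [← prod_mul_distrib]
  refine prod_congr rfl fun i hi => ?_
  rw [mem_range] at hi
  have := ha (2 * h + 1 - 2 * (i + 1)) (by omega)
  have h1 : a ^ (2 * (2 * h + 1 - (i + 1))) = a ^ (2 * h + 1) * a ^ (2 * h + 1 - 2 * (i + 1)) := by
    rw [← pow_add]
    congr 1
    omega
  rw [h1]
  field_simp
  ring

/-- The factor attached to `j` in the product formula for the numerator of `EQstar`. -/
noncomputable def eqFactor (p m j : ℕ) : RatFunc ℚ :=
  if p < 2 * (j * m % p) then
    1 + (q ^ (p * (2 * (j * m / p) + 2)) - 1) * (1 - q ^ (2 * absRes p m j))⁻¹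
  else 1 + (q ^ (p * (2 * (j * m / p))) - 1) * (1 - (1 - q ^ (2 * absRes p m j))⁻¹)

theorem not_dvd_two_mul_absRes {p m j : ℕ} [Fact p.Prime] (hodd : Odd p) (hpm : ¬ p ∣ m)
    (hj : j ∈ Icc 1 ((p - 1) / 2)) : ¬ p ∣ 2 * absRes p m j := by
  have hlt := Nat.mod_lt (j * m) (Fact.out : p.Prime).pos
  have h0 : j * m % p ≠ 0 := fun h =>
    not_dvd_mul_of_mem_Icc hpm hj (Nat.dvd_of_mod_eq_zero h)
  obtain ⟨t, ht⟩ := hodd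
  refine Nat.not_dvd_of_pos_of_lt ?_ ?_ <;> unfold absRes <;> split_ifs <;> omega

theorem numerator_EQstar_eq_prod {p m : ℕ} [Fact p.Prime] (hodd : Odd p) (hpm : ¬ p ∣ m) :
    (legendreSym p m : RatFunc ℚ) *
      q ^ (2 * ∑ j ∈ Rset p (m : ℤ), (p - res p ((j : ℤ) * m))) *
      (qpoch (q ^ (2 * m)) (q ^ (2 * m)) ((p - 1) / 2) /
        qpoch (q ^ 2) (q ^ 2) ((p - 1) / 2)) =
      ∏ j ∈ Icc 1 ((p - 1) / 2), eqFactor p m j := by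
  have hR : Rset p (m : ℤ) = (Icc 1 ((p - 1) / 2)).filter fun j => p < 2 * (j * m % p) := by
    ext j
    rw [mem_Rset_iff, mem_filter]
  rw [legendreSym_eq_neg_one_pow_card_Rset hodd hpm, qpoch_self, qpoch_self,
    ← prod_absRes hodd hpm (fun j => (1 : RatFunc ℚ) - (q ^ 2) ^ j), ← prod_div_distrib, mul_sum,
    ← prod_pow_eq_pow_sum, hR]
  push_cast
  rw [← prod_const, ← prod_mul_distrib, prod_filter, ← prod_mul_distrib]
  refine prod_congr rfl fun j hj => ?_
  have hne := one_sub_q_pow_ne_zero_of_not_dvd (not_dvd_two_mul_absRes hodd hpm hj)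
  have hdm := Nat.div_add_mod (j * m) p
  have hlt := Nat.mod_lt (j * m) (Fact.out : p.Prime).pos
  rw [res_natCast_mul, ← pow_mul, ← pow_mul, eqFactor]
  split_ifs with h
  · have hσ : absRes p m j = p - j * m % p := if_pos h
    rw [← hσ]
    have hpow : q ^ (p * (2 * (j * m / p) + 2)) = q ^ (2 * m * j) * q ^ (2 * absRes p m j) := by
      rw [← pow_add]
      congr 1
      rw [hσ, mul_add, mul_left_comm]
      have : 2 * m * j = 2 * (j * m) := by ring
      omega
    rw [hpow]
    field_simp
    ring
  · have hσ : absRes p m j = j * m % p := if_neg h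
    have hpow : q ^ (2 * m * j) = q ^ (p * (2 * (j * m / p))) * q ^ (2 * absRes p m j) := by
      rw [← pow_add]
      congr 1
      rw [hσ, mul_left_comm]
      have : 2 * m * j = 2 * (j * m) := by ring
      omega
    rw [hpow]
    field_simp
    ring

/-! ### Expansions of the products -/

theorem not_dvd_two_mul {p i : ℕ} [Fact p.Prime] (hodd : Odd p) (hi : ¬ p ∣ i) :
    ¬ p ∣ 2 * i := by
  rw [(Fact.out : p.Prime).dvd_mul, not_or]
  refine ⟨fun h => ?_, hi⟩
  rw [Nat.prime_dvd_prime_iff_eq Fact.out Nat.prime_two] at h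
  subst h
  exact absurd hodd (by decide)

theorem hasExpansion_eqFactor {p m j : ℕ} [Fact p.Prime] (hodd : Odd p) (hpm : ¬ p ∣ m)
    (hj : j ∈ Icc 1 ((p - 1) / 2)) :
    HasExpansion p (eqFactor p m j)
      (2 * ((j * m / p : ℕ) + if p < 2 * (j * m % p) then 1 else 0) *
        (1 - invRep ((2 * (j * m) : ℕ) : ZMod p))) := by
  have hσ := not_dvd_two_mul_absRes hodd hpm hj
  have hmod : ((j * m % p : ℕ) : ZMod p) = (j * m : ℕ) := ZMod.natCast_mod _ _
  have hlt := Nat.mod_lt (j * m) (Fact.out : p.Prime).pos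
  rw [eqFactor]
  split_ifs with h
  · have hc : ((2 * absRes p m j : ℕ) : ZMod p) = -((2 * (j * m) : ℕ) : ZMod p) := by
      rw [absRes, if_pos h, Nat.cast_mul, Nat.cast_sub hlt.le, hmod, ZMod.natCast_self]
      push_cast
      ring
    have := HasExpansion.of_congFirst (f := 2 * (j * m / p) + 2) (congFirst_invRep hσ)
      (invRep_mem_regRing hσ)
    rw [hc, invRep_neg] at this
    convert this using 1
    push_cast
    ring
  · have hc : ((2 * absRes p m j : ℕ) : ZMod p) = ((2 * (j * m) : ℕ) : ZMod p) := by
      rw [absRes, if_neg h, Nat.cast_mul, hmod, Nat.cast_mul 2 (j * m)]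
    have := HasExpansion.of_congFirst (f := 2 * (j * m / p)) (congFirst_invRep hσ).one_sub
      (sub_mem (one_mem _) (invRep_mem_regRing hσ))
    rw [hc] at this
    convert this using 1
    push_cast
    ring

theorem sum_invRep_two_mul {p m : ℕ} [Fact p.Prime] (hodd : Odd p) (hpm : ¬ p ∣ m) :
    ∑ j ∈ Icc 1 ((p - 1) / 2), invRep ((2 * j : ℕ) : ZMod p) =
      ∑ j ∈ Icc 1 ((p - 1) / 2), if p < 2 * (j * m % p) then
        1 - invRep ((2 * (j * m) : ℕ) : ZMod p) else invRep ((2 * (j * m) : ℕ) : ZMod p) := by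
  rw [← sum_absRes hodd hpm]
  refine sum_congr rfl fun j _ => ?_
  have hmod : ((j * m % p : ℕ) : ZMod p) = (j * m : ℕ) := ZMod.natCast_mod _ _
  have hlt := Nat.mod_lt (j * m) (Fact.out : p.Prime).pos
  rw [absRes, ← invRep_neg]
  split_ifs with h
  · congr 1
    rw [Nat.cast_mul, Nat.cast_sub hlt.le, hmod, ZMod.natCast_self]
    push_cast
    ring
  · rw [Nat.cast_mul, hmod, Nat.cast_mul 2 (j * m)]

theorem one_sub_q_pow_pow_ne_zero {m : ℕ} (hm : 0 < m) (i : ℕ) (hi : 0 < i) :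
    1 - (q ^ m) ^ i ≠ 0 := by
  rw [← pow_mul]
  exact one_sub_q_pow_ne_zero (Nat.mul_pos hm hi)

theorem hasExpansion_qpoch_sq_div {p m : ℕ} [Fact p.Prime] (hodd : Odd p) (hm : 0 < m)
    (hpm : ¬ p ∣ m) :
    HasExpansion p
      (qpoch ((q ^ m) ^ 2) ((q ^ m) ^ 2) (p - 1) / qpoch (q ^ m) (q ^ m) (p - 1))
      (∑ i ∈ Icc 1 ((p - 1) / 2), m * invRep ((2 * (i * m) : ℕ) : ZMod p)) := by
  rw [qpoch_sq_div_qpoch_eq_prod (one_sub_q_pow_pow_ne_zero hm) hodd]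
  refine HasExpansion.prod fun i hi => ?_
  have him := not_dvd_two_mul hodd (not_dvd_mul_of_mem_Icc hpm hi)
  rw [mem_Icc] at hi
  have hle : 2 * i ≤ p := by omega
  have hk : ((m * (p - 2 * i) : ℕ) : ZMod p) = -((2 * (i * m) : ℕ) : ZMod p) := by
    rw [Nat.cast_mul, Nat.cast_sub hle, ZMod.natCast_self]
    push_cast
    ring
  have hd : ¬ p ∣ m * (p - 2 * i) := by
    rwa [← ZMod.natCast_eq_zero_iff, hk, neg_eq_zero, ZMod.natCast_eq_zero_iff]
  have := HasExpansion.of_congFirst (f := m) (congFirst_invRep hd).one_sub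
    (sub_mem (one_mem _) (invRep_mem_regRing hd))
  rw [hk, invRep_neg, sub_sub_cancel, mul_comm p m, pow_mul, pow_mul] at this
  exact this

theorem hasExpansion_qbinom {p m n : ℕ} [Fact p.Prime] (hodd : Odd p) (hm : 0 < m)
    (hpm : ¬ p ∣ m) (hn : n < p) :
    HasExpansion p (qbinom (q ^ (2 * m)) (p - 1) n * q ^ (2 * m * (n + 1).choose 2) * (-1) ^ n)
      (∑ i ∈ Icc 1 n, 2 * m * invRep ((2 * (i * m) : ℕ) : ZMod p)) := by
  rw [pow_mul q (2 * m) ((n + 1).choose 2),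
    qbinom_pred_eq_prod (one_sub_q_pow_pow_ne_zero (Nat.mul_pos two_pos hm)) hn]
  refine HasExpansion.prod fun i hi => ?_
  rw [mem_Icc] at hi
  have hi' : ¬ p ∣ i := Nat.not_dvd_of_pos_of_lt hi.1 (by omega)
  have hd : ¬ p ∣ 2 * (i * m) :=
    not_dvd_two_mul hodd (by rw [(Fact.out : p.Prime).dvd_mul, not_or]; exact ⟨hi', hpm⟩)
  have := HasExpansion.of_congFirst (f := 2 * m) (congFirst_invRep hd) (invRep_mem_regRing hd)
  rw [← pow_mul, ← pow_mul, mul_comm (2 * m) p, mul_assoc 2 m i, mul_comm m i]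
  exact_mod_cast this

theorem hasExpansion_prod_qbinom {p m : ℕ} [Fact p.Prime] (hodd : Odd p) (hm : 0 < m)
    (hpm : ¬ p ∣ m) :
    HasExpansion p
      ((-1 : RatFunc ℚ) ^ (((p - 1) / 2) * (m / 2)) * (legendreSym p m : RatFunc ℚ) *
        (legendreSym p 2 : RatFunc ℚ) ^ (m - 1) *
        q ^ (2 * m * ∑ k ∈ Finset.Icc 1 (m / 2), (k * p / m + 1).choose 2) *
        ∏ k ∈ Finset.Icc 1 (m / 2), qbinom (q ^ (2 * m)) (p - 1) (k * p / m))
      (∑ i ∈ Icc 1 ((p - 1) / 2), 2 * m * ((m / 2 : ℕ) - (i * m / p : ℕ)) *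
        invRep ((2 * (i * m) : ℕ) : ZMod p)) := by
  have hp := (Fact.out : p.Prime).pos
  have hn : ∀ k ∈ Icc 1 (m / 2), k * p / m < p := by
    intro k hk
    rw [mem_Icc] at hk
    rw [Nat.div_lt_iff_lt_mul hm, mul_comm p m]
    exact Nat.mul_lt_mul_of_pos_right (by omega) hp
  have h := HasExpansion.prod (p := p) fun k hk => hasExpansion_qbinom hodd hm hpm (hn k hk)
  rw [sum_sum_Icc_mul_div hodd hm hpm] at h
  convert h using 1
  · rw [prod_mul_distrib, prod_mul_distrib, prod_pow_eq_pow_sum, prod_pow_eq_pow_sum, ← mul_sum]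
    have hs := sign_eq_one hodd hm hpm
    have hu : ((-1 : RatFunc ℚ) ^ (∑ k ∈ Icc 1 (m / 2), k * p / m)) ^ 2 = 1 := by
      rw [← pow_mul, mul_comm, pow_mul, neg_one_sq, one_pow]
    generalize (-1 : RatFunc ℚ) ^ (∑ k ∈ Icc 1 (m / 2), k * p / m) = u at *
    generalize (-1 : RatFunc ℚ) ^ (((p - 1) / 2) * (m / 2)) * (legendreSym p m : RatFunc ℚ) *
        (legendreSym p 2 : RatFunc ℚ) ^ (m - 1) = v at *
    have hv : v = u := by linear_combination u * hs - v * hu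
    rw [hv]
    ring
  · refine sum_congr rfl fun i hi => ?_
    have hle : i * m / p ≤ m / 2 := by
      rw [mem_Icc] at hi
      have h2 : 2 * i * m ≤ p * m := Nat.mul_le_mul_right m (by omega)
      rw [Nat.le_div_iff_mul_le two_pos, ← Nat.mul_le_mul_left_iff hp]
      have := Nat.mul_div_le (i * m) p
      nlinarith
    rw [nsmul_eq_mul, Nat.cast_sub hle]
    ring

theorem product_q_binomial_congruence (p : ℕ) [Fact p.Prime] (hp5 : 5 ≤ p)
    (m : ℕ) (hm : 2 ≤ m) (hpm : ¬ p ∣ m) :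
    qCong (pqn Polynomial.X p ^ 2)
      ((-1 : RatFunc ℚ) ^ (((p - 1) / 2) * (m / 2)) * (legendreSym p m : RatFunc ℚ) *
        (legendreSym p 2 : RatFunc ℚ) ^ (m - 1) *
        q ^ (2 * m * ∑ k ∈ Finset.Icc 1 (m / 2), (k * p / m + 1).choose 2) *
        ∏ k ∈ Finset.Icc 1 (m / 2), qbinom (q ^ (2 * m)) (p - 1) (k * p / m))
      (1 + (m : RatFunc ℚ) * qn q p * EQstar p m +
        ((2 * (m / 2) + 1 : ℕ) : RatFunc ℚ) * qn (q ^ m) p * QF p 2 (q ^ m) -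
        (m : RatFunc ℚ) * qn q p * QF p 2 q +
        (m : RatFunc ℚ) * (((Rset p (m : ℤ)).card : RatFunc ℚ) +
          2 * ((∑ j ∈ Finset.Icc 1 ((p - 1) / 2), j * m / p : ℕ) : RatFunc ℚ)) *
          (1 - q ^ p)) := by
  have hm0 : 0 < m := by omega
  have hodd : Odd p := (Fact.out : p.Prime).odd_of_ne_two (by omega)
  have hp : 0 < p := by omega
  have hq1 : qn q p ≠ 0 := fun h => one_sub_q_pow_ne_zero hp (by
    rw [← mul_neg_geom_sum, ← qn, h, mul_zero])
  have hqm : qn (q ^ m) p ≠ 0 := fun h => one_sub_q_pow_pow_ne_zero hm0 p hp (by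
    rw [← mul_neg_geom_sum, ← qn, h, mul_zero])
  have hE := HasExpansion.prod (p := p) fun j hj => hasExpansion_eqFactor hodd hpm hj
  rw [← numerator_EQstar_eq_prod hodd hpm] at hE
  have hF := hasExpansion_qpoch_sq_div hodd hm0 hpm
  have hG := hasExpansion_qpoch_sq_div hodd one_pos
    (fun h => (Fact.out : p.Prime).one_lt.ne' (Nat.dvd_one.1 h))
  simp only [pow_one, mul_one, Nat.cast_one, one_mul] at hG
  rw [sum_invRep_two_mul hodd hpm] at hG
  have hL := hasExpansion_prod_qbinom hodd hm0 hpm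
  have hR : ((Rset p (m : ℤ)).card : RatFunc ℚ) =
      ∑ j ∈ Icc 1 ((p - 1) / 2), if p < 2 * (j * m % p) then 1 else 0 := by
    rw [sum_boole]
    congr 2
  have hsum : ∑ i ∈ Icc 1 ((p - 1) / 2), 2 * m * (((m / 2 : ℕ) : RatFunc ℚ) - (i * m / p : ℕ)) *
        invRep ((2 * (i * m) : ℕ) : ZMod p) =
      m * (∑ j ∈ Icc 1 ((p - 1) / 2), (2 * (((j * m / p : ℕ) : RatFunc ℚ) +
          if p < 2 * (j * m % p) then 1 else 0) * (1 - invRep ((2 * (j * m) : ℕ) : ZMod p)))) +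
        ((2 * (m / 2) + 1 : ℕ) : RatFunc ℚ) *
          (∑ i ∈ Icc 1 ((p - 1) / 2), m * invRep ((2 * (i * m) : ℕ) : ZMod p)) -
        m * (∑ j ∈ Icc 1 ((p - 1) / 2), if p < 2 * (j * m % p) then
          1 - invRep ((2 * (j * m) : ℕ) : ZMod p) else invRep ((2 * (j * m) : ℕ) : ZMod p)) -
        m * ((Rset p (m : ℤ)).card +
          2 * ((∑ j ∈ Icc 1 ((p - 1) / 2), j * m / p : ℕ) : RatFunc ℚ)) := by
    rw [hR, Nat.cast_sum]
    simp only [mul_sum, mul_add, ← sum_add_distrib, ← sum_sub_distrib]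
    refine sum_congr rfl fun j _ => ?_
    split_ifs <;> push_cast <;> ring
  rw [EQstar, QF, QF, mul_assoc (m : RatFunc ℚ) (qn q p), mul_div_cancel₀ _ hq1,
    mul_assoc _ (qn (q ^ m) p), mul_div_cancel₀ _ hqm,
    mul_assoc (m : RatFunc ℚ) (qn q p), mul_div_cancel₀ _ hq1]
  obtain ⟨-, cE, hcE, hE⟩ := hE
  obtain ⟨-, cF, hcF, hF⟩ := hF
  obtain ⟨-, cG, hcG, hG⟩ := hG
  obtain ⟨-, cL, hcL, hL⟩ := hL
  refine qCong_of_sub_eq (c := cL - m * cE - ((2 * (m / 2) + 1 : ℕ) : RatFunc ℚ) * cF + m * cG)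
    hp ?_ ?_
  · exact add_mem (sub_mem (sub_mem hcL (mul_mem (natCast_mem _ m) hcE))
      (mul_mem (natCast_mem _ _) hcF)) (mul_mem (natCast_mem _ m) hcG)
  · rw [hL, hE, hF, hG, hsum]
    ring
end

section
/- Let p ≥ 5 be a prime and m an integer with p ∤ m, and let m' be a positive integer with m'·m ≡ 1 (mod p). Then 2 Σ_{j∈R_p(m)} 1/[2j]_q ≡ |R_p(m)|·(1−q) + Q_p(2,q^{m'})/[m']_q − Q_p(2,q) (mod [p]_q). -/
open Polynomial Finset

/-- The rational function `r` is regular at `z` and takes the value `v` there. -/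
def HasValueAt (z : ℂ) (r : RatFunc ℚ) (v : ℂ) : Prop :=
  ∃ N D : Polynomial ℚ, aeval z D ≠ 0 ∧
    r = algebraMap (Polynomial ℚ) (RatFunc ℚ) N / algebraMap (Polynomial ℚ) (RatFunc ℚ) D ∧
    v = aeval z N / aeval z D

namespace HasValueAt

variable {z : ℂ} {r s : RatFunc ℚ} {v w : ℂ}

lemma algebraMap_ne_zero_of_aeval_ne_zero {D : Polynomial ℚ} (h : aeval z D ≠ 0) :
    algebraMap (Polynomial ℚ) (RatFunc ℚ) D ≠ 0 := by
  intro h0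
  rw [map_eq_zero_iff _ (IsFractionRing.injective (Polynomial ℚ) (RatFunc ℚ))] at h0
  simp [h0] at h

lemma of_polynomial (N : Polynomial ℚ) :
    HasValueAt z (algebraMap (Polynomial ℚ) (RatFunc ℚ) N) (aeval z N) :=
  ⟨N, 1, by simp, by simp, by simp⟩

lemma add (hr : HasValueAt z r v) (hs : HasValueAt z s w) : HasValueAt z (r + s) (v + w) := by
  obtain ⟨N, D, hD, rfl, rfl⟩ := hr
  obtain ⟨N', D', hD', rfl, rfl⟩ := hs
  have h1 := algebraMap_ne_zero_of_aeval_ne_zero hD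
  have h2 := algebraMap_ne_zero_of_aeval_ne_zero hD'
  refine ⟨N * D' + D * N', D * D', by simp [hD, hD'], ?_, ?_⟩
  · simp only [map_add, map_mul]; rw [div_add_div _ _ h1 h2]
  · simp only [map_add, map_mul]; rw [div_add_div _ _ hD hD']

lemma mul (hr : HasValueAt z r v) (hs : HasValueAt z s w) : HasValueAt z (r * s) (v * w) := by
  obtain ⟨N, D, hD, rfl, rfl⟩ := hr
  obtain ⟨N', D', hD', rfl, rfl⟩ := hs
  refine ⟨N * N', D * D', by simp [hD, hD'], ?_, ?_⟩
  · simp only [map_mul]; rw [div_mul_div_comm]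
  · simp only [map_mul]; rw [div_mul_div_comm]

lemma inv (hr : HasValueAt z r v) (hv : v ≠ 0) : HasValueAt z r⁻¹ v⁻¹ := by
  obtain ⟨N, D, hD, rfl, rfl⟩ := hr
  refine ⟨D, N, fun h => hv (by simp [h]), ?_, ?_⟩ <;> rw [inv_div]

lemma div (hr : HasValueAt z r v) (hs : HasValueAt z s w) (hw : w ≠ 0) :
    HasValueAt z (r / s) (v / w) := by
  rw [div_eq_mul_inv, div_eq_mul_inv]
  exact hr.mul (hs.inv hw)

lemma sub (hr : HasValueAt z r v) (hs : HasValueAt z s w) : HasValueAt z (r - s) (v - w) := by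
  have h : HasValueAt z (-1) (-1) := by simpa using of_polynomial (z := z) (-1)
  simpa [sub_eq_add_neg] using hr.add (h.mul hs)

lemma natCast (n : ℕ) : HasValueAt z (n : RatFunc ℚ) n := by
  simpa using of_polynomial (z := z) (n : Polynomial ℚ)

lemma one : HasValueAt z 1 1 := by simpa using natCast (z := z) 1

lemma sum {ι : Type*} (s : Finset ι) (f : ι → RatFunc ℚ) (g : ι → ℂ)
    (h : ∀ i ∈ s, HasValueAt z (f i) (g i)) : HasValueAt z (∑ i ∈ s, f i) (∑ i ∈ s, g i) := by
  classical
  induction s using Finset.induction_on with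
  | empty => simpa using natCast (z := z) 0
  | insert a s ha ih =>
    rw [sum_insert ha, sum_insert ha]
    exact (h a (mem_insert_self a s)).add (ih fun i hi => h i (mem_insert_of_mem hi))

lemma qVar : HasValueAt z q z := by
  simpa [q] using of_polynomial (z := z) X

lemma qVar_pow (n : ℕ) : HasValueAt z (q ^ n) (z ^ n) := by
  simpa [q] using of_polynomial (z := z) (X ^ n)

lemma qInteger (n : ℕ) : HasValueAt z (qn q n) (∑ i ∈ range n, z ^ i) :=
  sum _ _ _ fun i _ => qVar_pow i

end HasValueAt

lemma pqn_X_eq_cyclotomic {p : ℕ} (hp : p.Prime) : pqn X p = cyclotomic p ℚ := by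
  have := Fact.mk hp
  rw [cyclotomic_prime]; rfl

lemma pqn_dvd_iff {p : ℕ} (hp : p.Prime) {z : ℂ} (hz : IsPrimitiveRoot z p) (N : Polynomial ℚ) :
    pqn X p ∣ N ↔ aeval z N = 0 := by
  rw [pqn_X_eq_cyclotomic hp, cyclotomic_eq_minpoly_rat hz hp.pos, minpoly.dvd_iff]

lemma qCong_of_hasValueAt {p : ℕ} (hp : p.Prime) {z : ℂ} (hz : IsPrimitiveRoot z p)
    {A B : RatFunc ℚ} (h : HasValueAt z (A - B) 0) : qCong (pqn X p) A B := by
  obtain ⟨N, D, hD, hAB, hv⟩ := h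
  have hN : aeval z N = 0 := by
    rcases div_eq_zero_iff.1 hv.symm with h | h
    · exact h
    · exact absurd h hD
  obtain ⟨M, rfl⟩ := (pqn_dvd_iff hp hz N).2 hN
  have hirr : Irreducible (pqn X p) := by
    rw [pqn_X_eq_cyclotomic hp]; exact cyclotomic.irreducible_rat hp.pos
  have hcop : IsCoprime D (pqn X p) :=
    ((hirr.coprime_iff_not_dvd).2 fun hd => hD ((pqn_dvd_iff hp hz D).1 hd)).symm
  have h0 : algebraMap (Polynomial ℚ) (RatFunc ℚ) (pqn X p) ≠ 0 := by
    simpa using hirr.ne_zero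
  have heq : (A - B) / algebraMap (Polynomial ℚ) (RatFunc ℚ) (pqn X p) =
      algebraMap (Polynomial ℚ) (RatFunc ℚ) M / algebraMap (Polynomial ℚ) (RatFunc ℚ) D := by
    rw [hAB, map_mul, mul_div_assoc, mul_div_cancel_left₀ _ h0]
  unfold qCong
  rw [heq]
  exact hcop.of_isCoprime_of_dvd_left (RatFunc.denom_div_dvd M D)

lemma q_pow_ne_one {n : ℕ} (hn : 0 < n) : q ^ n ≠ 1 := by
  intro h
  have h1 : (X : Polynomial ℚ) ^ n = 1 := by
    apply IsFractionRing.injective (Polynomial ℚ) (RatFunc ℚ)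
    simpa [q] using h
  have h2 := congrArg natDegree h1
  simp at h2
  omega

lemma qpoch_sq (a : RatFunc ℚ) (n : ℕ) :
    qpoch (a ^ 2) (a ^ 2) n = qpoch a a n * ∏ i ∈ range n, (1 + a ^ (i + 1)) := by
  unfold qpoch
  rw [← prod_mul_distrib]
  refine prod_congr rfl fun i _ => ?_
  ring

/-- The polynomial `∏_{i=1}^{p-1} (1 + X^i) - 1`, the numerator of `Q_p(2, X)`. -/
noncomputable def fermatNumerator (p : ℕ) : Polynomial ℚ :=
  ∏ i ∈ range (p - 1), (1 + X ^ (i + 1)) - 1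

section RootsOfUnity

variable {p : ℕ} {z : ℂ}

lemma one_add_ne_zero_of_pow_eq_one (hodd : Odd p) {x : ℂ} (hx : x ^ p = 1) : 1 + x ≠ 0 := by
  intro h
  have : x = -1 := by linear_combination h
  rw [this, hodd.neg_one_pow] at hx
  norm_num at hx

lemma prod_one_add_pow (hodd : Odd p) (hz : IsPrimitiveRoot z p) :
    ∏ i ∈ range (p - 1), (1 + z ^ (i + 1)) = 1 := by
  have hz2 : IsPrimitiveRoot (z ^ 2) p := hz.pow_of_coprime 2 hodd.coprime_two_left
  obtain ⟨n, rfl⟩ : ∃ n, p = n + 1 := ⟨p - 1, (Nat.sub_add_cancel hodd.pos).symm⟩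
  have h1 := hz.prod_one_sub_pow_eq_order
  have h2 := hz2.prod_one_sub_pow_eq_order
  have h3 : ∏ i ∈ range n, (1 - (z ^ 2) ^ (i + 1)) =
      (∏ i ∈ range n, (1 - z ^ (i + 1))) * ∏ i ∈ range n, (1 + z ^ (i + 1)) := by
    rw [← prod_mul_distrib]
    exact prod_congr rfl fun i _ => by ring
  rw [h2, h1] at h3
  have h4 : (n : ℂ) + 1 ≠ 0 := by exact_mod_cast n.succ_ne_zero
  exact (mul_eq_left₀ h4).1 h3.symm

lemma eval_derivative_prod (hodd : Odd p) (hz : z ^ p = 1) (n : ℕ) :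
    aeval z (derivative (∏ i ∈ range n, (1 + X ^ (i + 1)) : Polynomial ℚ)) =
      (∏ i ∈ range n, (1 + z ^ (i + 1))) *
        ∑ i ∈ range n, ((i + 1 : ℕ) : ℂ) * z ^ i / (1 + z ^ (i + 1)) := by
  induction n with
  | zero => simp
  | succ n ih =>
    have h : 1 + z ^ (n + 1) ≠ 0 := one_add_ne_zero_of_pow_eq_one hodd
      (by rw [← pow_mul, mul_comm, pow_mul, hz, one_pow])
    rw [prod_range_succ, prod_range_succ, sum_range_succ, derivative_mul, map_add, map_mul,
      map_mul, ih]
    simp [map_prod]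
    field_simp

lemma mul_eval_derivative_pqn (hp : 0 < p) (hz : z ^ p = 1) :
    aeval z (derivative (pqn X p)) * (z - 1) * z = p - z * aeval z (pqn X p) := by
  have h : pqn X p * (X - 1) = (X ^ p - 1 : Polynomial ℚ) := geom_sum_mul X p
  have h1 := congrArg (fun f => aeval z (derivative f)) h
  simp only [derivative_mul, map_add, map_mul, map_sub, derivative_X, derivative_one,
    derivative_X_pow, aeval_X, map_one, map_pow, map_natCast, sub_zero, mul_one] at h1
  have h2 : z ^ (p - 1) * z = 1 := by rw [← pow_succ, Nat.sub_add_cancel hp, hz]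
  linear_combination z * h1 + (p : ℂ) * h2

/-- The value of the `q`-Fermat quotient at a primitive `p`-th root of unity. -/
lemma eval_fermatQuotient (hp : p.Prime) (hodd : Odd p) (hz : IsPrimitiveRoot z p)
    {M : Polynomial ℚ} (hM : fermatNumerator p = pqn X p * M) :
    p * aeval z M = (z - 1) * ∑ i ∈ range p, (i : ℂ) * (z ^ i / (1 + z ^ i)) := by
  have h0 : aeval z (pqn X p) = 0 := (pqn_dvd_iff hp hz _).1 dvd_rfl
  have h1 := mul_eval_derivative_pqn hp.pos hz.pow_eq_one
  have h2 := congrArg (fun f => aeval z (derivative f)) hM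
  simp only [fermatNumerator, map_sub, derivative_one, sub_zero,
    eval_derivative_prod hodd hz.pow_eq_one, prod_one_add_pow hodd hz, derivative_mul, map_add,
    map_mul, h0] at h2
  have h3 : ∑ i ∈ range p, (i : ℂ) * (z ^ i / (1 + z ^ i)) =
      z * ∑ i ∈ range (p - 1), ((i + 1 : ℕ) : ℂ) * z ^ i / (1 + z ^ (i + 1)) := by
    obtain ⟨n, rfl⟩ : ∃ n, p = n + 1 := ⟨p - 1, (Nat.sub_add_cancel hp.pos).symm⟩
    rw [sum_range_succ', mul_sum]
    simp only [Nat.cast_zero, zero_mul, add_zero, Nat.add_sub_cancel]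
    refine sum_congr rfl fun i _ => ?_
    ring
  rw [h3]
  rw [h0] at h1
  linear_combination (-(aeval z M)) * h1 - (z - 1) * z * h2

lemma exists_fermatQuotient (hp : p.Prime) (hodd : Odd p) :
    ∃ M : Polynomial ℚ, fermatNumerator p = pqn X p * M := by
  have hz := Complex.isPrimitiveRoot_exp p hp.ne_zero
  refine (pqn_dvd_iff hp hz _).2 ?_
  simp [fermatNumerator, map_prod, prod_one_add_pow hodd hz]

lemma QF_two_eq (hp : p.Prime) {M : Polynomial ℚ} (hM : fermatNumerator p = pqn X p * M)
    {n : ℕ} (hn : 0 < n) :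
    QF p 2 (q ^ n) = algebraMap (Polynomial ℚ) (RatFunc ℚ) (M.comp (X ^ n)) := by
  have hpoch : qpoch (q ^ n) (q ^ n) (p - 1) ≠ 0 := by
    refine prod_ne_zero_iff.2 fun i _ h => q_pow_ne_one (n := n * (i + 1)) (by positivity) ?_
    rw [pow_mul]
    linear_combination -h
  have hqn : qn (q ^ n) p ≠ 0 := by
    intro h
    have h2 := geom_sum_mul (q ^ n) p
    rw [show ∑ i ∈ range p, (q ^ n) ^ i = 0 from h, zero_mul, ← pow_mul] at h2
    exact q_pow_ne_one (n := n * p) (Nat.mul_pos hn hp.pos) (by linear_combination -h2)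
  unfold QF
  rw [qpoch_sq, mul_div_cancel_left₀ _ hpoch, div_eq_iff hqn]
  have h := congrArg (fun f => algebraMap (Polynomial ℚ) (RatFunc ℚ) (f.comp (X ^ n))) hM
  simp only [mul_comp, map_mul] at h
  rw [mul_comm]
  convert h using 1
  · simp [fermatNumerator, q, Polynomial.prod_comp]
  · congr 1
    simp [pqn, qn, q, Polynomial.sum_comp]

lemma hasValueAt_QF_two (hp : p.Prime) {M : Polynomial ℚ}
    (hM : fermatNumerator p = pqn X p * M) {n : ℕ} (hn : 0 < n) :
    HasValueAt z (QF p 2 (q ^ n)) (aeval (z ^ n) M) := by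
  rw [QF_two_eq hp hM hn]
  simpa [aeval_comp] using HasValueAt.of_polynomial (z := z) (M.comp (X ^ n))

end RootsOfUnity

section OddFunction

/-- The function `x ↦ (1 + x) / (2 (1 - x))`, odd under `x ↦ x⁻¹`
(and equal to `0` at `x = 1` by convention). -/
noncomputable def cayley (x : ℂ) : ℂ := (1 + x) / (2 * (1 - x))

lemma cayley_one : cayley 1 = 0 := by simp [cayley]

lemma cayley_inv {x : ℂ} (hx : x ≠ 0) : cayley x⁻¹ = -cayley x := by
  by_cases h : x = 1
  · simp [h, cayley_one]
  have h1 : 1 - x ≠ 0 := fun h0 => h (by linear_combination -h0)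
  have h2 : x - 1 ≠ 0 := fun h0 => h (by linear_combination h0)
  unfold cayley
  field_simp
  ring

lemma div_one_add_eq_cayley {x : ℂ} (hx : 1 + x ≠ 0) :
    x / (1 + x) = 1 / 2 - 2 * cayley (x ^ 2) + cayley x := by
  by_cases h : x = 1
  · norm_num [h, cayley_one]
  have h1 : 1 - x ≠ 0 := fun h0 => h (by linear_combination -h0)
  have h2 : 1 - x ^ 2 ≠ 0 := by
    rw [show 1 - x ^ 2 = (1 - x) * (1 + x) by ring]; exact mul_ne_zero h1 hx
  have h3 : cayley (x ^ 2) = (1 + x ^ 2) / (2 * ((1 - x) * (1 + x))) := by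
    unfold cayley; congr 2; ring
  rw [h3]
  unfold cayley
  field_simp
  ring

lemma one_div_one_sub_eq_cayley {x : ℂ} (hx : x ≠ 1) : 1 / (1 - x) = cayley x + 1 / 2 := by
  have h1 : 1 - x ≠ 0 := fun h0 => hx (by linear_combination -h0)
  unfold cayley
  field_simp
  ring

end OddFunction

section Residues

variable {p : ℕ} [Fact p.Prime]

lemma sum_zmod_val {M : Type*} [AddCommMonoid M] (f : ℕ → M) :
    ∑ k : ZMod p, f k.val = ∑ i ∈ range p, f i :=
  sum_nbij' (fun k => k.val) (fun i => (i : ZMod p)) (fun k _ => mem_range.2 k.val_lt)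
    (fun _ _ => mem_univ _) (fun k _ => ZMod.natCast_zmod_val k)
    (fun _ hi => ZMod.val_cast_of_lt (mem_range.1 hi)) (fun _ _ => rfl)

/-- The indicator of the residues whose least non-negative representative exceeds `p / 2`. -/
def upperHalf (k : ZMod p) : ℂ := if p < 2 * k.val then 1 else 0

lemma upperHalf_neg (hodd : Odd p) {k : ZMod p} (hk : k ≠ 0) :
    upperHalf (-k) = 1 - upperHalf k := by
  have h1 : (-k).val = p - k.val := by rw [ZMod.neg_val, if_neg hk]
  have h2 := k.val_lt
  obtain ⟨n, hn⟩ := hodd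
  unfold upperHalf
  rw [h1]
  by_cases h : p < 2 * k.val
  · rw [if_pos h, if_neg (by omega)]; ring
  · rw [if_neg h, if_pos (by omega)]; ring

lemma val_two_mul_eq (hodd : Odd p) (k : ZMod p) :
    ((2 * k).val : ℂ) = 2 * k.val - p * upperHalf k := by
  have h2 := k.val_lt
  have h3 : (2 * k).val = (k.val + k.val) % p := by rw [two_mul, ZMod.val_add]
  obtain ⟨n, hn⟩ := hodd
  unfold upperHalf
  by_cases h : p < 2 * k.val
  · have h4 : (2 * k).val + p = 2 * k.val := by
      rw [h3, Nat.mod_eq_sub_mod (by omega), Nat.mod_eq_of_lt (by omega)]; omega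
    rw [if_pos h]
    have h5 : ((2 * k).val : ℂ) + p = 2 * k.val := by exact_mod_cast h4
    linear_combination h5
  · have h4 : (2 * k).val = 2 * k.val := by
      rw [h3, Nat.mod_eq_of_lt (by omega)]; omega
    rw [if_neg h, h4]
    push_cast; ring

lemma two_ne_zero_zmod (hodd : Odd p) : (2 : ZMod p) ≠ 0 := by
  intro h
  have h1 : p ∣ 2 := (ZMod.natCast_eq_zero_iff 2 p).1 (by exact_mod_cast h)
  have h2 := (Fact.out : p.Prime).two_le
  have h3 := Nat.le_of_dvd two_pos h1
  obtain ⟨n, hn⟩ := hodd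
  omega

lemma sum_comp_mul {c : ZMod p} (hc : c ≠ 0) (f : ZMod p → ℂ) :
    ∑ k, f (c * k) = ∑ k, f k :=
  Equiv.sum_comp (Equiv.mulLeft₀ c hc) f

variable (χ : AddChar (ZMod p) ℂ)

lemma addChar_pow_eq_one (k : ZMod p) : χ k ^ p = 1 := by
  rw [← AddChar.map_nsmul_eq_pow]; simp

lemma cayley_addChar_neg (k : ZMod p) : cayley (χ (-k)) = -cayley (χ k) := by
  rw [AddChar.map_neg_eq_inv, cayley_inv]
  intro h
  have := addChar_pow_eq_one χ k
  rw [h, zero_pow (Fact.out : p.Prime).ne_zero] at this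
  exact zero_ne_one this

lemma addChar_two_mul (k : ZMod p) : χ (2 * k) = χ k ^ 2 := by
  rw [two_mul, AddChar.map_add_eq_mul, sq]

lemma sum_val_sub_mul_div (hodd : Odd p) {c : ZMod p} (hc : c ≠ 0) :
    ∑ k : ZMod p, (((c * k).val : ℂ) - k.val) * (χ k / (1 + χ k)) =
      -p * ∑ k : ZMod p, (upperHalf (c * k) - upperHalf k) * cayley (χ (2 * k)) := by
  have h0 : ∑ k : ZMod p, (((c * k).val : ℂ) - k.val) = 0 := by
    rw [sum_sub_distrib, sum_comp_mul hc fun k => (k.val : ℂ), sub_self]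
  have h1 := sum_comp_mul (two_ne_zero_zmod hodd)
    fun k => (((c * k).val : ℂ) - k.val) * cayley (χ k)
  have h2 (k : ZMod p) : (((c * k).val : ℂ) - k.val) * (χ k / (1 + χ k)) =
      (((c * k).val : ℂ) - k.val) * (1 / 2) -
        2 * ((((c * k).val : ℂ) - k.val) * cayley (χ (2 * k))) +
        (((c * k).val : ℂ) - k.val) * cayley (χ k) := by
    rw [div_one_add_eq_cayley (one_add_ne_zero_of_pow_eq_one hodd (addChar_pow_eq_one χ k)),
      addChar_two_mul]
    ring
  simp only [h2]
  rw [sum_add_distrib, sum_sub_distrib, ← sum_mul, h0, zero_mul, ← h1, zero_sub, ← sum_neg_distrib,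
    ← sum_add_distrib, mul_sum]
  refine sum_congr rfl fun k _ => ?_
  rw [show c * (2 * k) = 2 * (c * k) by ring, val_two_mul_eq hodd, val_two_mul_eq hodd]
  ring

lemma sum_upperHalf_sub (hodd : Odd p) {c : ZMod p} (hc : c ≠ 0) :
    ∑ k : ZMod p, (upperHalf (c * k) - upperHalf k) * cayley (χ (2 * k)) =
      2 * ∑ k : ZMod p, (1 - upperHalf k) * upperHalf (c * k) * cayley (χ (2 * k)) := by
  set G : ZMod p → ℂ := fun k => (upperHalf (c * k) - upperHalf k) * cayley (χ (2 * k)) with hG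
  have h1 : ∑ k, upperHalf (-k) * G (-k) = ∑ k, upperHalf k * G k :=
    Equiv.sum_comp (Equiv.neg (ZMod p)) fun k => upperHalf k * G k
  have h2 (k : ZMod p) : upperHalf (-k) * G (-k) = (1 - upperHalf k) * G k := by
    by_cases hk : k = 0
    · simp [hG, hk, cayley_one]
    · simp only [hG]
      rw [mul_neg, mul_neg, upperHalf_neg hodd hk, upperHalf_neg hodd (mul_ne_zero hc hk),
        cayley_addChar_neg]
      ring
  have h3 : ∑ k, G k = ∑ k, (1 - upperHalf k) * G k + ∑ k, upperHalf k * G k := by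
    rw [← sum_add_distrib]
    exact sum_congr rfl fun k _ => by ring
  rw [h3, ← h1]
  simp only [h2]
  rw [← two_mul]
  congr 1
  refine sum_congr rfl fun k _ => ?_
  have h4 : (1 - upperHalf k) * upperHalf k = 0 := by
    unfold upperHalf; split_ifs <;> ring
  simp only [hG]
  linear_combination (-cayley (χ (2 * k))) * h4

lemma res_eq_val (j : ℕ) (m : ℤ) : res p ((j : ℤ) * m) = ((m : ZMod p) * (j : ZMod p)).val := by
  have h : ((((m : ZMod p) * (j : ZMod p)).val : ℕ) : ℤ) = ((j : ℤ) * m) % p := by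
    rw [← ZMod.val_intCast]
    push_cast
    rw [mul_comm]
  unfold res
  omega

lemma sum_Rset (hodd : Odd p) (m : ℤ) (f : ZMod p → ℂ) :
    ∑ j ∈ Rset p m, f j = ∑ k : ZMod p, (1 - upperHalf k) * upperHalf ((m : ZMod p) * k) * f k := by
  have h1 (k : ZMod p) : (1 - upperHalf k) * upperHalf ((m : ZMod p) * k) * f k =
      if ¬ p < 2 * k.val ∧ p < 2 * ((m : ZMod p) * k).val then f k else 0 := by
    unfold upperHalf
    split_ifs <;> first | (exfalso; tauto) | ring
  simp only [h1]
  rw [← sum_filter]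
  have hlt : ∀ j ∈ Rset p m, (j : ZMod p).val = j := fun j hj => by
    refine ZMod.val_cast_of_lt ?_
    have := mem_Icc.1 (mem_filter.1 hj).1
    have := (Fact.out : p.Prime).two_le
    omega
  refine sum_nbij' (fun j => (j : ZMod p)) (fun k => k.val) ?_ ?_ hlt
    (fun k _ => ZMod.natCast_zmod_val k) (fun _ _ => rfl)
  · intro j hj
    have hj' := mem_filter.1 hj
    have := mem_Icc.1 hj'.1
    rw [mem_filter, hlt j hj, ← res_eq_val]
    exact ⟨mem_univ _, by omega, hj'.2⟩
  · intro k hk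
    obtain ⟨-, hk1, hk2⟩ := mem_filter.1 hk
    have hk0 : k.val ≠ 0 := by
      intro h
      rw [ZMod.val_eq_zero] at h
      simp [h] at hk2
    obtain ⟨n, hn⟩ := hodd
    refine mem_filter.2 ⟨mem_Icc.2 ⟨by omega, by omega⟩, ?_⟩
    rw [res_eq_val, ZMod.natCast_zmod_val]
    exact hk2

end Residues

theorem sum_over_Rset_congruence (p : ℕ) (hp : p.Prime) (hp5 : 5 ≤ p)
    (m : ℤ) (hpm : ¬ (p : ℤ) ∣ m) (m' : ℕ) (hm' : 0 < m')
    (hinv : (m' : ℤ) * m ≡ 1 [ZMOD (p : ℤ)]) :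
    qCong (pqn Polynomial.X p)
      (2 * ∑ j ∈ Rset p m, 1 / qn q (2 * j))
      (((Rset p m).card : RatFunc ℚ) * (1 - q) + QF p 2 (q ^ m') / qn q m' -
        QF p 2 q) := by
  have := Fact.mk hp
  have hodd : Odd p := hp.odd_of_ne_two (by omega)
  have hp0 : (p : ℂ) ≠ 0 := by exact_mod_cast hp.ne_zero
  obtain ⟨M, hM⟩ := exists_fermatQuotient hp hodd
  have hz := Complex.isPrimitiveRoot_exp p hp.ne_zero
  set z : ℂ := Complex.exp (2 * Real.pi * Complex.I / p)
  have hz1 : z ≠ 1 := hz.ne_one hp.one_lt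
  have hz10 : z - 1 ≠ 0 := sub_ne_zero.2 hz1
  set χ : AddChar (ZMod p) ℂ := AddChar.zmodChar p hz.pow_eq_one
  have hχ (n : ℕ) : χ n = z ^ n := AddChar.zmodChar_apply' hz.pow_eq_one n
  have hχ1 {n : ℕ} (hn : ¬ p ∣ n) : z ^ n ≠ 1 := fun h => hn (hz.dvd_of_pow_eq_one n h)
  have hgeom (n : ℕ) : ∑ i ∈ range n, z ^ i = (z ^ n - 1) / (z - 1) :=
    geom_sum_eq hz1 n
  have hgeom0 {n : ℕ} (hn : ¬ p ∣ n) : ∑ i ∈ range n, z ^ i ≠ 0 := by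
    rw [hgeom]
    exact div_ne_zero (sub_ne_zero.2 (hχ1 hn)) hz10
  have hinvZ : (m : ZMod p) * (m' : ZMod p) = 1 := by
    have h := (ZMod.intCast_eq_intCast_iff _ _ p).2 hinv
    push_cast at h
    rw [mul_comm]; exact h
  have hc : (m : ZMod p) ≠ 0 := left_ne_zero_of_mul_eq_one hinvZ
  have hm'p : ¬ p ∣ m' := fun h => by
    rw [(ZMod.natCast_eq_zero_iff m' p).2 h, mul_zero] at hinvZ
    exact zero_ne_one hinvZ
  have hj {j : ℕ} (h : j ∈ Rset p m) : ¬ p ∣ 2 * j := fun hd => by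
    have h1 := mem_Icc.1 (mem_filter.1 h).1
    have h2 := Nat.le_of_dvd (by omega)
      (((Nat.coprime_primes hp Nat.prime_two).2 (by omega)).dvd_of_dvd_mul_left hd)
    omega
  -- the value of `Q_p(2, q^n) / [n]_q` as a sum over residue classes
  have hval {n : ℕ} (c : ZMod p) (hcn : c * n = 1) (hn : ¬ p ∣ n) :
      p * (aeval (z ^ n) M / ∑ i ∈ range n, z ^ i) =
        (z - 1) * ∑ k : ZMod p, ((c * k).val : ℂ) * (χ k / (1 + χ k)) := by
    have hn0 : (n : ZMod p) ≠ 0 := right_ne_zero_of_mul_eq_one hcn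
    have hzn : IsPrimitiveRoot (z ^ n) p :=
      hz.pow_of_coprime n ((Nat.Prime.coprime_iff_not_dvd hp).2 hn).symm
    have h1 := eval_fermatQuotient hp hodd hzn hM
    rw [← sum_zmod_val fun i => (i : ℂ) * ((z ^ n) ^ i / (1 + (z ^ n) ^ i))] at h1
    have h2 := sum_comp_mul hn0 fun k => ((c * k).val : ℂ) * (χ k / (1 + χ k))
    have h3 (k : ZMod p) : χ (n * k) = (z ^ n) ^ k.val := by
      rw [← pow_mul, ← hχ]; push_cast; rw [ZMod.natCast_zmod_val]
    simp only [h3, ← mul_assoc, hcn, one_mul] at h2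
    rw [← h2, ← mul_div_assoc, h1, hgeom]
    have := sub_ne_zero.2 (hχ1 hn)
    field_simp
  have hvm := hval (n := m') m hinvZ hm'p
  have hv1 := hval (n := 1) 1 (by simp) hp.not_dvd_one
  simp only [pow_one, range_one, sum_singleton, pow_zero, div_one, one_mul] at hv1
  have hdiff := sum_val_sub_mul_div χ hodd hc
  rw [sum_upperHalf_sub χ hodd hc, ← sum_Rset hodd m fun k => cayley (χ (2 * k))] at hdiff
  simp only [sub_mul, sum_sub_distrib] at hdiff
  refine qCong_of_hasValueAt hp hz ?_
  have hLHS : HasValueAt z (2 * ∑ j ∈ Rset p m, 1 / qn q (2 * j))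
      (2 * ∑ j ∈ Rset p m, 1 / ∑ i ∈ range (2 * j), z ^ i) := by
    simpa using (HasValueAt.natCast (z := z) 2).mul (HasValueAt.sum _ _ _ fun j hjR =>
      HasValueAt.one.div (HasValueAt.qInteger (2 * j)) (hgeom0 (hj hjR)))
  have hQ1 : HasValueAt z (QF p 2 q) (aeval z M) := by
    simpa using hasValueAt_QF_two (z := z) hp hM one_pos
  have hRHS := (((HasValueAt.natCast (z := z) (Rset p m).card).mul
    (HasValueAt.one.sub HasValueAt.qVar)).add ((hasValueAt_QF_two hp hM hm').div
      (HasValueAt.qInteger m') (hgeom0 hm'p))).sub hQ1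
  have hsum : ∑ j ∈ Rset p m, 1 / ∑ i ∈ range (2 * j), z ^ i =
      (1 - z) * (∑ j ∈ Rset p m, cayley (χ (2 * (j : ZMod p))) + (Rset p m).card * (1 / 2)) := by
    rw [← nsmul_eq_mul, ← sum_const, ← sum_add_distrib, mul_sum]
    refine sum_congr rfl fun j hjR => ?_
    have h1 := hχ1 (hj hjR)
    rw [show (2 * (j : ZMod p)) = ((2 * j : ℕ) : ZMod p) by push_cast; rfl, hχ,
      ← one_div_one_sub_eq_cayley h1, hgeom]
    have h2 : 1 - z ^ (2 * j) ≠ 0 := sub_ne_zero.2 h1.symm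
    have h3 := sub_ne_zero.2 h1
    field_simp
    ring
  convert hLHS.sub hRHS using 1
  rw [hsum]
  apply mul_left_cancel₀ hp0
  linear_combination hvm - hv1 + (z - 1) * hdiff
end

section
/- Let p be an odd prime and m, m' integers with p ∤ m and m'·m ≡ 1 (mod p). Then R_p(m) = {⟨−km'⟩_p : k ∈ R_p(m')}. -/
open Polynomial Finset

theorem res_modEq {p : ℕ} (hp : 0 < p) (x : ℤ) : (res p x : ℤ) ≡ x [ZMOD p] := by
  rw [res, Int.toNat_of_nonneg (Int.emod_nonneg _ (by omega))]
  exact Int.mod_modEq x p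

theorem res_lt {p : ℕ} (hp : 0 < p) (x : ℤ) : res p x < p := by
  have := Int.emod_lt_of_pos x (b := (p : ℤ)) (by omega)
  unfold res
  omega

theorem res_eq_of_modEq {p r : ℕ} {x : ℤ} (hr : r < p) (h : (r : ℤ) ≡ x [ZMOD p]) :
    res p x = r := by
  rw [res, ← h.eq, Int.emod_eq_of_lt (by omega) (by omega), Int.toNat_natCast]

theorem mem_Rset {p : ℕ} {m : ℤ} {j : ℕ} :
    j ∈ Rset p m ↔ (1 ≤ j ∧ j ≤ (p - 1) / 2) ∧ p < 2 * res p ((j : ℤ) * m) := by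
  simp [Rset]

/-- The map `k ↦ ⟨-k m'⟩_p` sends `R_p(m')` into `R_p(m)`, and `j ↦ ⟨-j m⟩_p` undoes it. -/
theorem res_neg_mul_mem_Rset {p : ℕ} {m m' : ℤ} (hp : 0 < p)
    (hinv : m' * m ≡ 1 [ZMOD (p : ℤ)]) {k : ℕ} (hk : k ∈ Rset p m') :
    res p (-(k : ℤ) * m') ∈ Rset p m ∧ res p (-(res p (-(k : ℤ) * m') : ℤ) * m) = k := by
  obtain ⟨⟨hk1, hk2⟩, hs⟩ := mem_Rset.mp hk
  have hsp := res_lt hp ((k : ℤ) * m')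
  have hneg : res p (-(k : ℤ) * m') = p - res p ((k : ℤ) * m') := by
    apply res_eq_of_modEq (by omega)
    rw [Nat.cast_sub hsp.le, neg_mul]
    simpa using (Int.modEq_zero_iff_dvd.mpr dvd_rfl).sub (res_modEq hp ((k : ℤ) * m'))
  have hmul : (res p (-(k : ℤ) * m') : ℤ) * m ≡ -k [ZMOD p] := by
    calc (res p (-(k : ℤ) * m') : ℤ) * m ≡ -(k : ℤ) * m' * m [ZMOD p] :=
          (res_modEq hp _).mul_right m
      _ = -(k : ℤ) * (m' * m) := mul_assoc _ _ _
      _ ≡ -(k : ℤ) * 1 [ZMOD p] := hinv.mul_left _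
      _ = -k := mul_one _
  have hres : res p ((res p (-(k : ℤ) * m') : ℤ) * m) = p - k := by
    apply res_eq_of_modEq (by omega)
    rw [Nat.cast_sub (by omega)]
    refine Int.ModEq.trans ?_ hmul.symm
    simpa using (Int.modEq_zero_iff_dvd.mpr (dvd_refl (p : ℤ))).sub_right (k : ℤ)
  refine ⟨mem_Rset.mpr ⟨by omega, by omega⟩, res_eq_of_modEq (by omega) ?_⟩
  rw [neg_mul]
  simpa using hmul.neg.symm

theorem Rset_eq_image (p : ℕ) (hp : p.Prime) (hodd : Odd p)
    (m m' : ℤ) (hpm : ¬ (p : ℤ) ∣ m) (hinv : m' * m ≡ 1 [ZMOD (p : ℤ)]) :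
    Rset p m = (Rset p m').image fun k : ℕ => res p (-(k : ℤ) * m') := by
  have hinv' : m * m' ≡ 1 [ZMOD (p : ℤ)] := by rwa [mul_comm]
  ext j
  rw [Finset.mem_image]
  constructor
  · intro hj
    exact ⟨_, res_neg_mul_mem_Rset hp.pos hinv' hj⟩
  · rintro ⟨k, hk, rfl⟩
    exact (res_neg_mul_mem_Rset hp.pos hinv hk).1
end
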